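/- Under the variable metric forward–backward setup, if in addition the interior of Z is nonempty and there exists a summable sequence (ν_n) in [0,∞) such that (1+ν_n)⟪U_n x, x⟫ ≥ ⟪U_{n+1} x, x⟫ for all n and all x, then the sequence (x_n) converges strongly to some point x̄ ∈ Z. -/

import Mathlib

open RealInnerProductSpace Filter Topology

section Sequences

theorem Summable.mul_of_nonneg_same {f g : ℕ → ℝ} (hf : Summable f) (hg : Summable g)
    (hf0 : ∀ n, 0 ≤ f n) (hg0 : ∀ n, 0 ≤ g n) : Summable fun n => f n * g n :=
  Summable.of_nonneg_of_le (fun n => mul_nonneg (hf0 n) (hg0 n))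
    (fun n => mul_le_mul_of_nonneg_right (hf.le_tsum n fun j _ => hf0 j) (hg0 n))
    (hg.mul_left (∑' i, f i))

theorem Summable.one_add_mul_one_add_sub_one {f g : ℕ → ℝ} (hf : Summable f) (hg : Summable g)
    (hf0 : ∀ n, 0 ≤ f n) (hg0 : ∀ n, 0 ≤ g n) :
    Summable fun n => (1 + f n) * (1 + g n) - 1 :=
  ((hf.add hg).add (hf.mul_of_nonneg_same hg hf0 hg0)).congr fun n => by ring

/-- A nonnegative sequence with `r (n + 1) ≤ (1 + δ n) * r n + θ n` for summable nonnegative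
`δ` and `θ` is bounded. -/
theorem exists_bound_of_le_one_add_mul_add {r δ θ : ℕ → ℝ} (hr : ∀ n, 0 ≤ r n)
    (hδ0 : ∀ n, 0 ≤ δ n) (hδ : Summable δ) (hθ0 : ∀ n, 0 ≤ θ n) (hθ : Summable θ)
    (h : ∀ n, r (n + 1) ≤ (1 + δ n) * r n + θ n) : ∃ C, 0 ≤ C ∧ ∀ n, r n ≤ C := by
  have key : ∀ n, r n ≤ Real.exp (∑ i ∈ Finset.range n, δ i) *
      (r 0 + ∑ i ∈ Finset.range n, θ i) := by
    intro n
    induction n with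
    | zero => simp
    | succ n ih =>
      rw [Finset.sum_range_succ, Finset.sum_range_succ, Real.exp_add]
      set E := Real.exp (∑ i ∈ Finset.range n, δ i)
      set S := ∑ i ∈ Finset.range n, θ i
      have hE : 1 ≤ E := Real.one_le_exp (Finset.sum_nonneg fun i _ => hδ0 i)
      have hd : 1 + δ n ≤ Real.exp (δ n) := by linarith [Real.add_one_le_exp (δ n)]
      have hd0 := hδ0 n
      have hEd : 1 ≤ E * Real.exp (δ n) :=
        one_le_mul_of_one_le_of_one_le hE (by linarith)
      calc r (n + 1) ≤ (1 + δ n) * r n + θ n := h n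
        _ ≤ Real.exp (δ n) * (E * (r 0 + S)) + E * Real.exp (δ n) * θ n :=
          add_le_add (mul_le_mul hd ih (hr n) (Real.exp_pos _).le)
            (le_mul_of_one_le_left (hθ0 n) hEd)
        _ = E * Real.exp (δ n) * (r 0 + (S + θ n)) := by ring
  have hT : 0 ≤ ∑' i, θ i := tsum_nonneg hθ0
  refine ⟨Real.exp (∑' i, δ i) * (r 0 + ∑' i, θ i),
    mul_nonneg (Real.exp_pos _).le (add_nonneg (hr 0) hT), fun n => (key n).trans ?_⟩
  have h1 := hδ.sum_le_tsum (Finset.range n) fun i _ => hδ0 i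
  have h2 := hθ.sum_le_tsum (Finset.range n) fun i _ => hθ0 i
  have h3 : 0 ≤ ∑ i ∈ Finset.range n, θ i := Finset.sum_nonneg fun i _ => hθ0 i
  exact mul_le_mul (Real.exp_le_exp.2 h1) (by linarith) (add_nonneg (hr 0) h3)
    (Real.exp_pos _).le

theorem summable_of_le_sub_add {d r e : ℕ → ℝ} (hd : ∀ n, 0 ≤ d n) (hr : ∀ n, 0 ≤ r n)
    (he0 : ∀ n, 0 ≤ e n) (he : Summable e) (h : ∀ n, d n ≤ r n - r (n + 1) + e n) :
    Summable d := by
  refine summable_of_sum_range_le (c := r 0 + ∑' i, e i) hd fun n => ?_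
  have h1 : ∑ i ∈ Finset.range n, d i ≤ r 0 - r n + ∑ i ∈ Finset.range n, e i := by
    rw [← Finset.sum_range_sub' r n, ← Finset.sum_add_distrib]
    exact Finset.sum_le_sum fun i _ => h i
  linarith [he.sum_le_tsum (Finset.range n) fun i _ => he0 i, hr n]

end Sequences

section Metric

variable {H : Type*} [NormedAddCommGroup H] [InnerProductSpace ℝ H]

theorem norm_le_of_abs_inner_self_le {D : H →L[ℝ] H} (hD : (D : H →ₗ[ℝ] H).IsSymmetric) {K : ℝ}
    (hK : 0 ≤ K) (h : ∀ x, |⟪D x, x⟫| ≤ K * ‖x‖ ^ 2) : ‖D‖ ≤ K := by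
  rw [D.norm_eq_iSup_rayleighQuotient hD]
  refine ciSup_le fun x => ?_
  rw [ContinuousLinearMap.rayleighQuotient, ContinuousLinearMap.reApplyInnerSelf_apply, abs_div,
    abs_of_nonneg (sq_nonneg ‖x‖)]
  exact div_le_of_le_mul₀ (sq_nonneg _) hK (h x)

theorem exists_inverse_of_coercive [CompleteSpace H] {T : H →L[ℝ] H} {α : ℝ} (hα : 0 < α)
    (hT : ∀ x, ⟪T x, x⟫ ≥ α * ‖x‖ ^ 2) :
    ∃ W : H →L[ℝ] H, (∀ x, T (W x) = x) ∧ ∀ x, W (T x) = x := by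
  have hu : IsUnit T := by
    refine ContinuousLinearMap.isUnit_of_forall_le_norm_inner_map T (c := ⟨α, hα.le⟩) hα
      fun x => ?_
    have := hT x
    calc ‖x‖ ^ 2 * α ≤ ⟪T x, x⟫ := by linarith
      _ ≤ ‖⟪T x, x⟫‖ := Real.le_norm_self _
  obtain ⟨V, rfl⟩ := hu
  refine ⟨(V⁻¹ : (H →L[ℝ] H)ˣ), fun x => ?_, fun x => ?_⟩
  · exact congrArg (fun S : H →L[ℝ] H => S x) V.mul_inv
  · exact congrArg (fun S : H →L[ℝ] H => S x) V.inv_mul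

/-- `W` is the inverse of the symmetric operator `T`, with `α ≤ T ≤ μ`. -/
structure IsMetricInverse (α μ : ℝ) (T W : H →L[ℝ] H) : Prop where
  symm : ∀ x y, ⟪T x, y⟫ = ⟪x, T y⟫
  coercive : ∀ x, ⟪T x, x⟫ ≥ α * ‖x‖ ^ 2
  norm_le : ‖T‖ ≤ μ
  right_inv : ∀ x, T (W x) = x
  left_inv : ∀ x, W (T x) = x

namespace IsMetricInverse

variable {α μ : ℝ} {T W : H →L[ℝ] H}

theorem inv_symm (h : IsMetricInverse α μ T W) (x y : H) : ⟪W x, y⟫ = ⟪x, W y⟫ := by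
  conv_lhs => rw [← h.right_inv y]
  rw [← h.symm, h.right_inv]

theorem norm_inv_apply_le (h : IsMetricInverse α μ T W) (hα : 0 < α) (x : H) :
    ‖W x‖ ≤ ‖x‖ / α := by
  rw [le_div_iff₀ hα]
  have h1 := h.coercive (W x)
  rw [h.right_inv] at h1
  have h2 := real_inner_le_norm x (W x)
  rcases (norm_nonneg (W x)).eq_or_lt with h0 | h0
  · rw [← h0]; simp
  · refine le_of_mul_le_mul_right ?_ h0
    nlinarith

theorem inner_inv_self_le (h : IsMetricInverse α μ T W) (hα : 0 < α) (x : H) :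
    ⟪W x, x⟫ ≤ ‖x‖ ^ 2 / α := by
  calc ⟪W x, x⟫ ≤ ‖W x‖ * ‖x‖ := real_inner_le_norm _ _
    _ ≤ ‖x‖ / α * ‖x‖ :=
      mul_le_mul_of_nonneg_right (h.norm_inv_apply_le hα x) (norm_nonneg _)
    _ = ‖x‖ ^ 2 / α := by ring

theorem inner_apply_self_le (h : IsMetricInverse α μ T W) (x : H) : ⟪T x, x⟫ ≤ μ * ‖x‖ ^ 2 := by
  calc ⟪T x, x⟫ ≤ ‖T x‖ * ‖x‖ := real_inner_le_norm _ _
    _ ≤ μ * ‖x‖ * ‖x‖ :=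
      mul_le_mul_of_nonneg_right (T.le_of_opNorm_le h.norm_le x) (norm_nonneg _)
    _ = μ * ‖x‖ ^ 2 := by ring

theorem norm_sq_le_inner_inv (h : IsMetricInverse α μ T W) (hα : 0 < α) (hμ : 0 < μ) (x : H) :
    ‖x‖ ^ 2 ≤ μ * ⟪W x, x⟫ := by
  have h1 : 0 ≤ ⟪T (W x - μ⁻¹ • x), W x - μ⁻¹ • x⟫ :=
    le_trans (by positivity) (h.coercive _)
  have h2 := h.inner_apply_self_le x
  have h3 : ⟪T x, W x⟫ = ‖x‖ ^ 2 := by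
    rw [h.symm, h.right_inv, real_inner_self_eq_norm_sq]
  simp only [map_sub, map_smul, h.right_inv, inner_sub_left, inner_sub_right, inner_smul_left,
    inner_smul_right, real_inner_self_eq_norm_sq, h3, conj_trivial] at h1
  have h4 : μ⁻¹ * (μ⁻¹ * ⟪T x, x⟫) ≤ μ⁻¹ * ‖x‖ ^ 2 := by
    refine mul_le_mul_of_nonneg_left ?_ (by positivity)
    rw [inv_mul_le_iff₀ hμ]; exact h2
  have h5 : μ⁻¹ * ‖x‖ ^ 2 ≤ ⟪W x, x⟫ := by
    linarith [real_inner_comm (W x) x]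
  rwa [inv_mul_le_iff₀ hμ] at h5

theorem inner_inv_self_nonneg (h : IsMetricInverse α μ T W) (hα : 0 < α) (x : H) :
    0 ≤ ⟪W x, x⟫ := by
  have := h.coercive (W x)
  rw [h.right_inv, real_inner_comm] at this
  exact le_trans (by positivity) this

theorem inner_inv_sub_self (h : IsMetricInverse α μ T W) (x y : H) :
    ⟪W (x - y), x - y⟫ = ⟪W x, x⟫ - 2 * ⟪W x, y⟫ + ⟪W y, y⟫ := by
  simp only [map_sub, inner_sub_left, inner_sub_right]
  rw [h.inv_symm y x, real_inner_comm (W x) y]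
  ring

theorem inner_inv_add_self (h : IsMetricInverse α μ T W) (x y : H) :
    ⟪W (x + y), x + y⟫ = ⟪W x, x⟫ + 2 * ⟪W x, y⟫ + ⟪W y, y⟫ := by
  have := h.inner_inv_sub_self x (-y)
  simpa using this

/-- Inversion reverses the order of quadratic forms. -/
theorem inner_inv_le_mul_inner_inv {T' W' : H →L[ℝ] H} (h : IsMetricInverse α μ T W)
    (h' : IsMetricInverse α μ T' W') (hα : 0 < α) {c : ℝ} (hc : 0 < c)
    (hle : ∀ x, ⟪T x, x⟫ ≤ c * ⟪T' x, x⟫) (x : H) : ⟪W' x, x⟫ ≤ c * ⟪W x, x⟫ := by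
  have h1 : 0 ≤ ⟪T (W x - c⁻¹ • W' x), W x - c⁻¹ • W' x⟫ :=
    le_trans (by positivity) (h.coercive _)
  have h2 := hle (W' x)
  rw [h'.right_inv, real_inner_comm (W' x) x] at h2
  have h3 : ⟪T (W' x), W x⟫ = ⟪W' x, x⟫ := by rw [h.symm, h.right_inv]
  simp only [map_sub, map_smul, h.right_inv, inner_sub_left, inner_sub_right, inner_smul_left,
    inner_smul_right, h3, conj_trivial] at h1
  rw [real_inner_comm (W' x) x, real_inner_comm (W x) x] at h1
  have h4 : c⁻¹ * (c⁻¹ * ⟪T (W' x), W' x⟫) ≤ c⁻¹ * ⟪W' x, x⟫ := by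
    refine mul_le_mul_of_nonneg_left ?_ (by positivity)
    rw [inv_mul_le_iff₀ hc]
    exact h2
  rw [← inv_mul_le_iff₀ hc]
  linarith

theorem inner_inv_add_smul_sub_le (h : IsMetricInverse α μ T W) (hα : 0 < α) {l : ℝ}
    (hl0 : 0 ≤ l) (hl1 : l ≤ 1) (x y : H) :
    ⟪W (x + l • (y - x)), x + l • (y - x)⟫ ≤ (1 - l) * ⟪W x, x⟫ + l * ⟪W y, y⟫ := by
  have h1 := h.inner_inv_add_self x (l • (y - x))
  have h2 := h.inner_inv_add_self x (y - x)
  rw [add_sub_cancel] at h2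
  simp only [map_smul, inner_smul_left, inner_smul_right, conj_trivial] at h1
  have h3 := h.inner_inv_self_nonneg hα (y - x)
  rw [h1, h2]
  nlinarith [mul_nonneg (mul_nonneg hl0 (sub_nonneg.2 hl1)) h3]

theorem inner_inv_add_self_le (h : IsMetricInverse α μ T W) (hα : 0 < α) (hμ : 0 < μ)
    (x a : H) : ⟪W (x + a), x + a⟫ ≤
      (1 + μ / α * ‖a‖) * ⟪W x, x⟫ + α⁻¹ * (‖a‖ + ‖a‖ * ‖a‖) := by
  have h1 := h.inner_inv_add_self x a
  have h2 := h.inner_inv_self_le hα a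
  have h3 := h.norm_sq_le_inner_inv hα hμ x
  have h4 : 2 * ⟪W x, a⟫ ≤ α⁻¹ * (1 + μ * ⟪W x, x⟫) * ‖a‖ := by
    calc 2 * ⟪W x, a⟫ ≤ 2 * (‖x‖ / α * ‖a‖) := by
          have := mul_le_mul_of_nonneg_right (h.norm_inv_apply_le hα x) (norm_nonneg a)
          linarith [real_inner_le_norm (W x) a]
      _ = α⁻¹ * (2 * ‖x‖) * ‖a‖ := by ring
      _ ≤ α⁻¹ * (1 + μ * ⟪W x, x⟫) * ‖a‖ := by
          gcongr
          nlinarith [sq_nonneg (‖x‖ - 1)]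
  have h5 : ‖a‖ ^ 2 / α = α⁻¹ * (‖a‖ * ‖a‖) := by ring
  have h6 : μ / α * ‖a‖ * ⟪W x, x⟫ = α⁻¹ * (μ * ⟪W x, x⟫) * ‖a‖ := by ring
  linarith

theorem inv_sub_eq_smul (h : IsMetricInverse α μ T W) {γ : ℝ} {x p f b u : H}
    (hp : x - γ • T (f + b) - p = γ • T u) : W (x - p) = γ • (u + f + b) := by
  have hxp : x - p = T (γ • (u + f + b)) := by
    have : x - p = γ • T u + γ • T (f + b) := by rw [← hp]; abel
    rw [this]
    simp only [map_add, map_smul, smul_add]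
    abel
  rw [hxp, h.left_inv]

/-- The perturbed forward–backward operator is nonexpansive towards solutions `z`, up to the
perturbation `b`. Here `f` and `g` are the values of the cocoercive operator at `x` and `z`. -/
theorem inner_inv_forwardBackward_sub_le (h : IsMetricInverse α μ T W) (hα : 0 < α)
    (hμ : 0 < μ) {β γ : ℝ} (hγ : 0 ≤ γ) (hγμ : γ * μ ≤ 2 * β) {x p z f g b u : H}
    (hp : x - γ • T (f + b) - p = γ • T u) (hmono : 0 ≤ ⟪p - z, u + g⟫)
    (hcoc : β * ‖f - g‖ ^ 2 ≤ ⟪x - z, f - g⟫) :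
    ⟪W (p - z), p - z⟫ ≤ ⟪W (x - z), x - z⟫ + 2 * (γ * (‖p - z‖ * ‖b‖)) := by
  have hW := h.inv_sub_eq_smul hp
  have h1 : ⟪W (x - z), x - z⟫ =
      ⟪W (x - p), x - p⟫ + 2 * ⟪W (x - p), p - z⟫ + ⟪W (p - z), p - z⟫ := by
    rw [← h.inner_inv_add_self, sub_add_sub_cancel]
  have h2 : ⟪W (x - p), p - z⟫ =
      γ * (⟪p - z, u + g⟫ + ⟪x - z, f - g⟫ - ⟪x - p, f - g⟫ + ⟪p - z, b⟫) := by
    have e : ⟪p - z, f - g⟫ = ⟪x - z, f - g⟫ - ⟪x - p, f - g⟫ := by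
      rw [← inner_sub_left]; congr 1; abel
    rw [add_sub_assoc, ← e, hW, inner_smul_left, conj_trivial, real_inner_comm,
      ← inner_add_right, ← inner_add_right]
    congr 2
    abel
  have h3 := h.norm_sq_le_inner_inv hα hμ (x - p)
  have h4 : 2 * (γ * ⟪x - p, f - g⟫) ≤ ⟪W (x - p), x - p⟫ + γ * (2 * β * ‖f - g‖ ^ 2) := by
    have e1 : γ * ⟪x - p, f - g⟫ ≤ γ * (‖x - p‖ * ‖f - g‖) :=
      mul_le_mul_of_nonneg_left (real_inner_le_norm _ _) hγ
    have e2 : μ⁻¹ * ‖x - p‖ ^ 2 ≤ ⟪W (x - p), x - p⟫ := by rwa [inv_mul_le_iff₀ hμ]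
    have e3 : γ * (γ * μ * ‖f - g‖ ^ 2) ≤ γ * (2 * β * ‖f - g‖ ^ 2) := by gcongr
    have e4 : 0 ≤ μ⁻¹ * (‖x - p‖ - γ * μ * ‖f - g‖) ^ 2 := by positivity
    have e5 : μ⁻¹ * (‖x - p‖ - γ * μ * ‖f - g‖) ^ 2 =
        μ⁻¹ * ‖x - p‖ ^ 2 - 2 * (γ * (‖x - p‖ * ‖f - g‖)) + γ * (γ * μ * ‖f - g‖ ^ 2) := by
      field_simp
      ring
    linarith
  have h5 : -(γ * (‖p - z‖ * ‖b‖)) ≤ γ * ⟪p - z, b⟫ := by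
    have := mul_le_mul_of_nonneg_left (neg_le_of_abs_le (abs_real_inner_le_norm (p - z) b)) hγ
    linarith
  have h6 := mul_nonneg hγ hmono
  have h7 := mul_le_mul_of_nonneg_left hcoc hγ
  rw [h2] at h1
  linarith

end IsMetricInverse

theorem le_one_add_mul_add_of_le_add_mul {P S m κ μ : ℝ} (hμ : 0 < μ)
    (hκ : 0 ≤ κ) (hm : m ^ 2 ≤ μ * P) (h : P ≤ S + 2 * (κ * m)) :
    P ≤ (1 + 2 * μ * κ) * S + 2 * (κ + μ * (κ * κ) + μ ^ 2 * (κ * κ * κ)) := by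
  have h1 : m ^ 2 ≤ μ * (S + 2 * (κ * m)) := hm.trans (mul_le_mul_of_nonneg_left h hμ.le)
  have hmb : m ≤ κ * μ + (1 + μ * S + (κ * μ) ^ 2) := by
    have : (m - κ * μ) ^ 2 ≤ μ * S + (κ * μ) ^ 2 := by linarith
    nlinarith [sq_nonneg (m - κ * μ - 1)]
  have := mul_le_mul_of_nonneg_left hmb hκ
  linarith

/-- One inexact relaxed step of the variable metric forward–backward iteration, from metric
`W` to metric `W'`. -/
theorem IsMetricInverse.inner_inv_step_le {α μ : ℝ} {T W W' : H →L[ℝ] H}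
    (h : IsMetricInverse α μ T W) (hα : 0 < α) (hμ : 0 < μ) {η : ℝ} (hη : 0 ≤ η)
    (hW : ∀ v, ⟪W' v, v⟫ ≤ (1 + η) * ⟪W v, v⟫)
    {β γ Γ l : ℝ} (hγ : 0 ≤ γ) (hγΓ : γ ≤ Γ) (hγμ : γ * μ ≤ 2 * β) (hl0 : 0 ≤ l) (hl1 : l ≤ 1)
    {x x' p z f g a b u : H}
    (hp : x - γ • T (f + b) - p = γ • T u) (hmono : 0 ≤ ⟪p - z, u + g⟫)
    (hcoc : β * ‖f - g‖ ^ 2 ≤ ⟪x - z, f - g⟫) (hx : x' = x + l • (p + a - x)) :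
    ⟪W' (x' - z), x' - z⟫ ≤ (1 + η) * ((1 + μ / α * ‖a‖) *
      ((1 + 2 * μ * (Γ * ‖b‖)) * ⟪W (x - z), x - z⟫ + 2 * (Γ * ‖b‖ +
        μ * (Γ * ‖b‖ * (Γ * ‖b‖)) + μ ^ 2 * (Γ * ‖b‖ * (Γ * ‖b‖) * (Γ * ‖b‖)))) +
      α⁻¹ * (‖a‖ + ‖a‖ * ‖a‖)) := by
  have hΓ : 0 ≤ Γ := hγ.trans hγΓ
  set κ := Γ * ‖b‖ with hκ
  have hκ0 : 0 ≤ κ := by positivity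
  set S := ⟪W (x - z), x - z⟫
  have hS : 0 ≤ S := h.inner_inv_self_nonneg hα _
  have h1 := h.inner_inv_forwardBackward_sub_le hα hμ hγ hγμ hp hmono hcoc
  have h2 : ⟪W (p - z), p - z⟫ ≤ S + 2 * (κ * ‖p - z‖) := by
    have : γ * (‖p - z‖ * ‖b‖) ≤ Γ * (‖p - z‖ * ‖b‖) := by gcongr
    rw [hκ]
    linarith
  have h3 := le_one_add_mul_add_of_le_add_mul hμ hκ0 (h.norm_sq_le_inner_inv hα hμ (p - z)) h2
  set c := 2 * (κ + μ * (κ * κ) + μ ^ 2 * (κ * κ * κ))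
  have hc : 0 ≤ c := by positivity
  have h4 := h.inner_inv_add_self_le hα hμ (p - z) a
  set c' := α⁻¹ * (‖a‖ + ‖a‖ * ‖a‖)
  have hc' : 0 ≤ c' := by positivity
  have hk' : 0 ≤ μ / α * ‖a‖ := by positivity
  have h5 : ⟪W (p - z + a), p - z + a⟫ ≤
      (1 + μ / α * ‖a‖) * ((1 + 2 * μ * κ) * S + c) + c' :=
    h4.trans (by gcongr)
  have h6 : S ≤ (1 + μ / α * ‖a‖) * ((1 + 2 * μ * κ) * S + c) + c' := by
    have e1 : S ≤ (1 + 2 * μ * κ) * S + c := by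
      have : 0 ≤ 2 * μ * κ * S := by positivity
      linarith
    have e2 : 0 ≤ μ / α * ‖a‖ * ((1 + 2 * μ * κ) * S + c) := by positivity
    linarith
  have h7 := h.inner_inv_add_smul_sub_le hα hl0 hl1 (x - z) (p - z + a)
  have h8 : x' - z = x - z + l • (p - z + a - (x - z)) := by
    rw [hx, show p - z + a - (x - z) = p + a - x by abel]; abel
  rw [h8]
  refine (hW _).trans (mul_le_mul_of_nonneg_left (h7.trans ?_) (by linarith))
  have e1 := mul_le_mul_of_nonneg_left h6 (sub_nonneg.2 hl1)
  have e2 := mul_le_mul_of_nonneg_left h5 hl0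
  linarith

/-- A sequence that is quasi-Fejér monotone, in summably varying metrics, with respect to every
point of a ball converges strongly. -/
theorem exists_tendsto_of_quasiFejer_closedBall [CompleteSpace H] {α μ : ℝ} (hα : 0 < α)
    (hμ : 0 < μ) {U W : ℕ → H →L[ℝ] H} (h : ∀ n, IsMetricInverse α μ (U n) (W n))
    {η ν : ℕ → ℝ} (hη0 : ∀ n, 0 ≤ η n) (hη : Summable η) (hν0 : ∀ n, 0 ≤ ν n) (hν : Summable ν)
    (hUη : ∀ n v, ⟪U n v, v⟫ ≤ (1 + η n) * ⟪U (n + 1) v, v⟫)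
    (hUν : ∀ n v, ⟪U (n + 1) v, v⟫ ≤ (1 + ν n) * ⟪U n v, v⟫)
    {δ θ : ℕ → ℝ} (hδ0 : ∀ n, 0 ≤ δ n) (hδ : Summable δ) (hθ0 : ∀ n, 0 ≤ θ n) (hθ : Summable θ)
    {x : ℕ → H} {ρ : ℝ} (hρ : 0 < ρ)
    (hF : ∀ w, ‖w‖ ≤ ρ → ∀ n, ⟪W (n + 1) (x (n + 1) - w), x (n + 1) - w⟫ ≤
      (1 + δ n) * ⟪W n (x n - w), x n - w⟫ + θ n) :
    ∃ xb, Tendsto x atTop (𝓝 xb) := by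
  set s : ℕ → H := fun n => W n (x n) with hs
  have hUs : ∀ n, U n (s n) = x n := fun n => (h n).right_inv _
  obtain ⟨C, hC0, hC⟩ : ∃ C, 0 ≤ C ∧ ∀ n, ⟪W n (x n), x n⟫ ≤ C := by
    refine exists_bound_of_le_one_add_mul_add (fun n => (h n).inner_inv_self_nonneg hα _)
      hδ0 hδ hθ0 hθ fun n => ?_
    simpa using hF 0 (by simpa using hρ.le) n
  obtain ⟨M, hM0, hM⟩ : ∃ M, 0 ≤ M ∧ ∀ w, ‖w‖ ≤ ρ → ∀ n, ⟪W n (x n - w), x n - w⟫ ≤ M := by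
    refine ⟨2 * C + 2 * (ρ ^ 2 / α), by positivity, fun w hw n => ?_⟩
    have h1 := (h n).inner_inv_sub_self (x n) w
    have h2 := (h n).inner_inv_add_self (x n) w
    have h3 := (h n).inner_inv_self_nonneg hα (x n + w)
    have h4 : ⟪W n w, w⟫ ≤ ρ ^ 2 / α := ((h n).inner_inv_self_le hα w).trans (by gcongr)
    linarith [hC n]
  have hds : Summable fun n => ‖s (n + 1) - s n‖ := by
    have key : ∀ n, 2 * ρ * ‖s (n + 1) - s n‖ ≤ ⟪W n (x n), x n⟫ -
        ⟪W (n + 1) (x (n + 1)), x (n + 1)⟫ + (δ n * M + θ n + ν n * (ρ ^ 2 / α)) := by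
      intro n
      set D := s n - s (n + 1) with hD
      set w : H := ρ • (‖D‖⁻¹ • D) with hw
      have hwρ : ‖w‖ ≤ ρ := by
        rw [hw, norm_smul, norm_smul, norm_inv, norm_norm, Real.norm_of_nonneg hρ.le]
        exact mul_le_of_le_one_right hρ.le inv_mul_le_one
      have hDw : ⟪D, w⟫ = ρ * ‖D‖ := by
        rw [hw, inner_smul_right, inner_smul_right, real_inner_self_eq_norm_sq]
        rcases eq_or_ne ‖D‖ 0 with h0 | h0
        · simp [h0]
        · field_simp
      have h1 := hF w hwρ n
      have h2 : δ n * ⟪W n (x n - w), x n - w⟫ ≤ δ n * M :=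
        mul_le_mul_of_nonneg_left (hM w hwρ n) (hδ0 n)
      have h3 := (h (n + 1)).inner_inv_sub_self (x (n + 1)) w
      have h4 := (h n).inner_inv_sub_self (x n) w
      have h5 : ⟪W n w, w⟫ ≤ (1 + ν n) * ⟪W (n + 1) w, w⟫ :=
        (h (n + 1)).inner_inv_le_mul_inner_inv (h n) hα (by linarith [hν0 n]) (hUν n) w
      have h6 : ν n * ⟪W (n + 1) w, w⟫ ≤ ν n * (ρ ^ 2 / α) :=
        mul_le_mul_of_nonneg_left
          (((h (n + 1)).inner_inv_self_le hα w).trans (by gcongr)) (hν0 n)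
      have h7 : ⟪D, w⟫ = ⟪W n (x n), w⟫ - ⟪W (n + 1) (x (n + 1)), w⟫ := by
        rw [hD, inner_sub_left]
      rw [norm_sub_rev]
      linarith
    have := summable_of_le_sub_add (fun n => by positivity)
      (fun n => (h n).inner_inv_self_nonneg hα (x n))
      (fun n => by have := hδ0 n; have := hθ0 n; have := hν0 n; positivity)
      (((hδ.mul_right M).add hθ).add (hν.mul_right (ρ ^ 2 / α))) key
    exact (summable_mul_left_iff (by positivity)).1 this
  have hsb : ∃ K, 0 ≤ K ∧ ∀ n, ‖s n‖ ≤ K := by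
    refine ⟨(1 + μ * C) / α, by positivity, fun n => ((h n).norm_inv_apply_le hα _).trans ?_⟩
    have := (h n).norm_sq_le_inner_inv hα hμ (x n)
    have := mul_le_mul_of_nonneg_left (hC n) hμ.le
    gcongr
    nlinarith [sq_nonneg (‖x n‖ - 1)]
  obtain ⟨K, hK0, hK⟩ := hsb
  have hdU : ∀ n, ‖U (n + 1) - U n‖ ≤ (η n + ν n) * μ := by
    intro n
    have hη0n := hη0 n
    have hν0n := hν0 n
    refine norm_le_of_abs_inner_self_le (fun v w => ?_) (by positivity) fun v => ?_
    · have h1 := (h (n + 1)).symm v w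
      have h2 := (h n).symm v w
      simp only [ContinuousLinearMap.coe_coe, sub_apply, inner_sub_left,
        inner_sub_right, h1, h2]
    · rw [sub_apply, inner_sub_left, abs_le]
      have h1 := hUη n v
      have h2 := hUν n v
      have h3 := mul_le_mul_of_nonneg_left ((h (n + 1)).inner_apply_self_le v) hη0n
      have h4 := mul_le_mul_of_nonneg_left ((h n).inner_apply_self_le v) hν0n
      have h5 : 0 ≤ η n * (μ * ‖v‖ ^ 2) := by positivity
      have h6 : 0 ≤ ν n * (μ * ‖v‖ ^ 2) := by positivity
      constructor <;> linarith
  have hdx : Summable fun n => dist (x n) (x n.succ) := by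
    refine Summable.of_nonneg_of_le (fun _ => dist_nonneg) (fun n => ?_)
      ((hds.mul_left μ).add ((hη.add hν).mul_right (μ * K)))
    have e : x (n + 1) - x n = U (n + 1) (s (n + 1) - s n) + (U (n + 1) - U n) (s n) := by
      rw [map_sub, sub_apply, hUs, hUs]; abel
    rw [dist_comm, dist_eq_norm, Nat.succ_eq_add_one, e]
    refine (norm_add_le _ _).trans (add_le_add ((U (n + 1)).le_of_opNorm_le (h _).norm_le _) ?_)
    have hη0n := hη0 n
    have hν0n := hν0 n
    calc ‖(U (n + 1) - U n) (s n)‖ ≤ (η n + ν n) * μ * ‖s n‖ :=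
          ContinuousLinearMap.le_of_opNorm_le _ (hdU n) _
      _ ≤ (η n + ν n) * μ * K := by gcongr; exact hK n
      _ = (η n + ν n) * (μ * K) := by ring
  exact cauchySeq_tendsto_of_complete (cauchySeq_of_summable_dist hdx)

end Metric



/-- **Variable metric forward–backward splitting: strong convergence under nonempty
interior.** Under the variable metric forward–backward setup, if `Z` has nonempty
interior and `(1+ν n)⟪U n x, x⟫ ≥ ⟪U (n+1) x, x⟫` for some summable nonnegative `(ν n)`,
then `x n` converges strongly to some point of `Z`. -/
theorem variable_metric_forward_backward_strong_interior
    {H : Type*} [NormedAddCommGroup H] [InnerProductSpace ℝ H] [CompleteSpace H]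
    (A : H → Set H)
    (hAmono : ∀ x y u v : H, u ∈ A x → v ∈ A y → ⟪x - y, u - v⟫ ≥ 0)
    (hAmax : ∀ y v : H, (∀ x u : H, u ∈ A x → ⟪x - y, u - v⟫ ≥ 0) → v ∈ A y)
    (β : ℝ) (hβ : 0 < β) (B : H → H)
    (hB : ∀ x y : H, ⟪x - y, B x - B y⟫ ≥ β * ‖B x - B y‖ ^ 2)
    (η : ℕ → ℝ) (hη0 : ∀ n, 0 ≤ η n) (hηsum : Summable η)
    (α : ℝ) (hα : 0 < α)
    (U : ℕ → H →L[ℝ] H) (hUsa : ∀ n, IsSelfAdjoint (U n))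
    (hUα : ∀ n (x : H), ⟪U n x, x⟫ ≥ α * ‖x‖ ^ 2)
    (μ : ℝ) (hμ : IsLUB (Set.range fun n => ‖U n‖) μ)
    (hUmono : ∀ n (x : H), (1 + η n) * ⟪U (n + 1) x, x⟫ ≥ ⟪U n x, x⟫)
    (ε : ℝ) (hε : ε ∈ Set.Ioc 0 (min 1 (2 * β / (μ + 1))))
    (lam : ℕ → ℝ) (hlam : ∀ n, lam n ∈ Set.Icc ε 1)
    (gam : ℕ → ℝ) (hgam : ∀ n, gam n ∈ Set.Icc ε ((2 * β - ε) / μ))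
    (a b : ℕ → H) (ha : Summable fun n => ‖a n‖) (hb : Summable fun n => ‖b n‖)
    (Z : Set H) (hZdef : Z = {x : H | -B x ∈ A x}) (hZ : Z.Nonempty)
    (x y p : ℕ → H)
    (hy : ∀ n, y n = x n - gam n • U n (B (x n) + b n))
    (hp : ∀ n, y n - p n ∈ (fun u => gam n • U n u) '' A (p n))
    (hx : ∀ n, x (n + 1) = x n + lam n • (p n + a n - x n))
    (hint : (interior Z).Nonempty)
    (ν : ℕ → ℝ) (hν0 : ∀ n, 0 ≤ ν n) (hνsum : Summable ν)
    (hUmono' : ∀ n (w : H), (1 + ν n) * ⟪U n w, w⟫ ≥ ⟪U (n + 1) w, w⟫) :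
    ∃ xb ∈ Z, Tendsto x atTop (𝓝 xb) := by
  have hε0 : 0 < ε := hε.1
  have hUμ : ∀ n, ‖U n‖ ≤ μ := fun n => hμ.1 ⟨n, rfl⟩
  have hμ0 : 0 < μ := by
    refine lt_of_le_of_ne ((norm_nonneg _).trans (hUμ 0)) fun h0 => ?_
    have h1 := (hgam 0).1.trans (hgam 0).2
    rw [← h0, div_zero] at h1
    linarith
  have hgam0 : ∀ n, 0 < gam n := fun n => hε0.trans_le (hgam n).1
  have hgamμ : ∀ n, gam n * μ ≤ 2 * β := fun n => by
    have := (le_div_iff₀ hμ0).1 (hgam n).2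
    linarith
  set Γ := (2 * β - ε) / μ
  have hΓ : 0 ≤ Γ := (hgam0 0).le.trans (hgam 0).2
  choose W hUW hWU using fun n => exists_inverse_of_coercive hα (hUα n)
  have hI : ∀ n, IsMetricInverse α μ (U n) (W n) := fun n =>
    ⟨fun v w => (hUsa n).isSymmetric v w, hUα n, hUμ n, hUW n, hWU n⟩
  choose u huA hu using hp
  have hp' : ∀ n, x n - gam n • U n (B (x n) + b n) - p n = gam n • U n (u n) := fun n => by
    rw [← hy]; exact (hu n).symm
  obtain ⟨z, hz⟩ := hint
  obtain ⟨ρ, hρ, hball⟩ := Metric.nhds_basis_closedBall.mem_iff.1 (mem_interior_iff_mem_nhds.1 hz)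
  -- coefficients of the quasi-Fejér inequality
  set κ : ℕ → ℝ := fun n => Γ * ‖b n‖
  have hκ0 : ∀ n, 0 ≤ κ n := fun n => by positivity
  have hκ : Summable κ := hb.mul_left Γ
  have hκκ0 : ∀ n, 0 ≤ κ n * κ n := fun n => mul_nonneg (hκ0 n) (hκ0 n)
  have hκκ : Summable fun n => κ n * κ n := hκ.mul_of_nonneg_same hκ hκ0 hκ0
  set c : ℕ → ℝ := fun n => 2 * (κ n + μ * (κ n * κ n) + μ ^ 2 * (κ n * κ n * κ n))
  have hc0 : ∀ n, 0 ≤ c n := fun n => by have := hκ0 n; positivity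
  have hc : Summable c := (((hκ.add (hκκ.mul_left μ)).add
    ((hκκ.mul_of_nonneg_same hκ hκκ0 hκ0).mul_left (μ ^ 2))).mul_left 2)
  set c' : ℕ → ℝ := fun n => α⁻¹ * (‖a n‖ + ‖a n‖ * ‖a n‖)
  have hc'0 : ∀ n, 0 ≤ c' n := fun n => by positivity
  have hc' : Summable c' := (ha.add (ha.mul_of_nonneg_same ha (fun n => norm_nonneg _)
    fun n => norm_nonneg _)).mul_left α⁻¹
  set k : ℕ → ℝ := fun n => 2 * μ * κ n
  have hk0 : ∀ n, 0 ≤ k n := fun n => by have := hκ0 n; positivity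
  have hk : Summable k := hκ.mul_left (2 * μ)
  set k' : ℕ → ℝ := fun n => μ / α * ‖a n‖
  have hk'0 : ∀ n, 0 ≤ k' n := fun n => by positivity
  have hk' : Summable k' := ha.mul_left (μ / α)
  set ξ : ℕ → ℝ := fun n => (1 + η n) * (1 + k' n) - 1
  have hξ : Summable ξ := hηsum.one_add_mul_one_add_sub_one hk' hη0 hk'0
  have hξ0 : ∀ n, 0 ≤ ξ n := fun n => by
    have := mul_nonneg (hη0 n) (hk'0 n)
    have := hη0 n
    have := hk'0 n
    simp only [ξ]
    linarith
  set δ : ℕ → ℝ := fun n => (1 + ξ n) * (1 + k n) - 1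
  have hδ : Summable δ := hξ.one_add_mul_one_add_sub_one hk hξ0 hk0
  have hδ0 : ∀ n, 0 ≤ δ n := fun n => by
    have := mul_nonneg (hξ0 n) (hk0 n)
    have := hξ0 n
    have := hk0 n
    simp only [δ]
    linarith
  set θ : ℕ → ℝ := fun n => ξ n * c n + c n + (η n * c' n + c' n)
  have hθ : Summable θ := ((hξ.mul_of_nonneg_same hc hξ0 hc0).add hc).add
    ((hηsum.mul_of_nonneg_same hc' hη0 hc'0).add hc')
  have hθ0 : ∀ n, 0 ≤ θ n := fun n => by
    have := hξ0 n
    have := hc0 n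
    have := hc'0 n
    have := hη0 n
    positivity
  obtain ⟨xz, hxz⟩ := exists_tendsto_of_quasiFejer_closedBall hα hμ0 hI hη0 hηsum hν0 hνsum
    hUmono hUmono' hδ0 hδ hθ0 hθ hρ (x := fun n => x n - z) <| by
    intro w hw n
    have hzw : -B (z + w) ∈ A (z + w) := by
      have : z + w ∈ Z := hball (by simpa [dist_eq_norm] using hw)
      rwa [hZdef] at this
    have hmono := hAmono _ _ _ _ (huA n) hzw
    rw [sub_neg_eq_add] at hmono
    have := (hI n).inner_inv_step_le hα hμ0 (hη0 n)
      ((hI n).inner_inv_le_mul_inner_inv (hI (n + 1)) hα (by linarith [hη0 n]) (hUmono n))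
      (hgam0 n).le (hgam n).2 (hgamμ n) (hε0.le.trans (hlam n).1) (hlam n).2 (hp' n) hmono
      (hB _ _) (hx n)
    simp only [sub_sub]
    refine this.trans (le_of_eq ?_)
    simp only [δ, θ, ξ, k, k', c, c', κ]
    ring
  have hxb : Tendsto x atTop (𝓝 (xz + z)) := by
    simpa using hxz.add_const z
  set xb := xz + z
  refine ⟨xb, ?_, hxb⟩
  -- identification of the limit
  have ha0 : Tendsto a atTop (𝓝 0) := tendsto_zero_iff_norm_tendsto_zero.2 ha.tendsto_atTop_zero
  have hb0 : Tendsto b atTop (𝓝 0) := tendsto_zero_iff_norm_tendsto_zero.2 hb.tendsto_atTop_zero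
  have hstep : Tendsto (fun n => x (n + 1) - x n) atTop (𝓝 0) := by
    simpa using ((tendsto_add_atTop_iff_nat 1).2 hxb).sub hxb
  have hq : Tendsto (fun n => p n + a n - x n) atTop (𝓝 0) := by
    refine squeeze_zero_norm (a := fun n => ε⁻¹ * ‖x (n + 1) - x n‖) (fun n => ?_) ?_
    · rw [hx n, add_sub_cancel_left, norm_smul, Real.norm_of_nonneg (hε0.le.trans (hlam n).1),
        ← div_eq_inv_mul, le_div_iff₀ hε0, mul_comm]
      exact mul_le_mul_of_nonneg_right (hlam n).1 (norm_nonneg _)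
    · simpa using hstep.norm.const_mul ε⁻¹
  have hxp : Tendsto (fun n => x n - p n) atTop (𝓝 0) := by
    have := ha0.sub hq
    simp only [sub_zero] at this
    exact this.congr fun n => by abel
  have hpb : Tendsto p atTop (𝓝 xb) := by
    have := hxb.sub hxp
    simpa using this
  have hBx : Tendsto (fun n => B (x n)) atTop (𝓝 (B xb)) := by
    rw [tendsto_iff_norm_sub_tendsto_zero]
    refine squeeze_zero (g := fun n => β⁻¹ * ‖x n - xb‖) (fun n => norm_nonneg _) (fun n => ?_) ?_
    · rw [← div_eq_inv_mul, le_div_iff₀ hβ]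
      have h1 := (hB (x n) xb).le.trans (real_inner_le_norm _ _)
      rcases (norm_nonneg (B (x n) - B xb)).eq_or_lt with h0 | h0
      · rw [← h0]; simp
      · refine le_of_mul_le_mul_right ?_ h0
        linarith
    · simpa using (tendsto_iff_norm_sub_tendsto_zero.1 hxb).const_mul β⁻¹
  have hr : Tendsto (fun n => u n + B (x n) + b n) atTop (𝓝 0) := by
    refine squeeze_zero_norm (a := fun n => ε⁻¹ * (‖x n - p n‖ / α)) (fun n => ?_) ?_
    · have h1 := (hI n).inv_sub_eq_smul (hp' n)
      have h2 := (hI n).norm_inv_apply_le hα (x n - p n)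
      rw [h1, norm_smul, Real.norm_of_nonneg (hgam0 n).le] at h2
      rw [← div_eq_inv_mul, le_div_iff₀ hε0, mul_comm]
      exact (mul_le_mul_of_nonneg_right (hgam n).1 (norm_nonneg _)).trans h2
    · simpa using (hxp.norm.div_const α).const_mul ε⁻¹
  have hub : Tendsto u atTop (𝓝 (-B xb)) := by
    have := (hr.sub hBx).sub hb0
    simp only [zero_sub, sub_zero] at this
    exact this.congr fun n => by abel
  rw [hZdef]
  refine hAmax _ _ fun w v hv => ?_
  exact ge_of_tendsto' ((hpb.const_sub w).inner (hub.const_sub v)) fun n =>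
    hAmono _ _ _ _ hv (huA n)
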